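/- arXiv:1904.10360 — 7 statements merged into one kernel-verified Lean document; each statement's English description precedes it below -/
import Mathlib

section
/- For every dimension d ≥ 1, every real p > 0, and every sequence u_1, …, u_n of unit vectors in ℝ^d, the maximum over unit vectors v ∈ S^{d-1} of Σ_{i=1}^n |⟨v, u_i⟩|^p is at least n · μ_{d,p}, where μ_{d,p} = Γ(d/2)Γ((p+1)/2)/(√π · Γ((d+p)/2)). -/
open scoped RealInnerProductSpace

/-- `μ_{d,p} = Γ(d/2)Γ((p+1)/2)/(√π · Γ((d+p)/2))`. -/
noncomputable def polarizationMu (d : ℕ) (p : ℝ) : ℝ :=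
  Real.Gamma (d / 2) * Real.Gamma ((p + 1) / 2) /
    (Real.sqrt Real.pi * Real.Gamma ((d + p) / 2))

open MeasureTheory

lemma polar_abs_integral (p : ℝ) (hp : 0 < p) :
    ∫ t : ℝ, |t| ^ p * Real.exp (-|t| ^ 2) = Real.Gamma ((p + 1) / 2) := by
  rw [integral_comp_abs (f := fun t => t ^ p * Real.exp (-t ^ 2))]
  have h := integral_rpow_mul_exp_neg_rpow (p := 2) (q := p) (by norm_num) (by linarith)
  simp only [Real.rpow_two] at h
  rw [h]; ring

lemma polar_gauss : ∫ t : ℝ, Real.exp (-|t| ^ 2) = Real.sqrt Real.pi := by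
  have h := integral_gaussian 1
  simpa using h

lemma polar_A (k : ℕ) (p : ℝ) (hp : 0 < p) (u : EuclideanSpace ℝ (Fin (k + 1)))
    (hu : ‖u‖ = 1) :
    ∫ x : EuclideanSpace ℝ (Fin (k + 1)), |⟪x, u⟫| ^ p * Real.exp (-‖x‖ ^ 2) =
      Real.Gamma ((p + 1) / 2) * Real.sqrt Real.pi ^ k := by
  have ho : Orthonormal ℝ (Set.domRestrict ({0} : Set (Fin (k + 1))) (fun _ => u)) := by
    constructor
    · intro i; simpa using hu
    · intro i j hij
      exact absurd (Subsingleton.elim i j) hij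
  obtain ⟨b, hb⟩ := ho.exists_orthonormalBasis_extension_of_card_eq (by simp)
  have hb0 : b 0 = u := hb 0 (by simp)
  have h1 : ∀ x : EuclideanSpace ℝ (Fin (k + 1)),
      |⟪x, u⟫| ^ p * Real.exp (-‖x‖ ^ 2) =
        (fun y : EuclideanSpace ℝ (Fin (k + 1)) => |y 0| ^ p * Real.exp (-‖y‖ ^ 2)) (b.repr x) := by
    intro x
    simp only [LinearIsometryEquiv.norm_map, OrthonormalBasis.repr_apply_apply, hb0]
    rw [real_inner_comm]
  rw [integral_congr_ae (Filter.Eventually.of_forall h1),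
    b.repr.measurePreserving.integral_comp b.repr.toHomeomorph.measurableEmbedding
      (fun y : EuclideanSpace ℝ (Fin (k + 1)) => |y 0| ^ p * Real.exp (-‖y‖ ^ 2))]
  let f : Fin (k + 1) → ℝ → ℝ := fun i t =>
    if i = 0 then |t| ^ p * Real.exp (-|t| ^ 2) else Real.exp (-|t| ^ 2)
  have h2 : ∀ y : EuclideanSpace ℝ (Fin (k + 1)), |y 0| ^ p * Real.exp (-‖y‖ ^ 2) =
      (fun z : Fin (k + 1) → ℝ => ∏ i, f i (z i)) (WithLp.ofLp y) := by
    intro y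
    simp only [f]
    rw [Fin.prod_univ_succ, EuclideanSpace.norm_sq_eq, ← Finset.sum_neg_distrib, Real.exp_sum,
      Fin.prod_univ_succ]
    simp [Fin.succ_ne_zero, mul_assoc]
  rw [integral_congr_ae (Filter.Eventually.of_forall h2),
    (PiLp.volume_preserving_ofLp (Fin (k + 1))).integral_comp
      (MeasurableEquiv.toLp 2 (Fin (k + 1) → ℝ)).symm.measurableEmbedding
      (fun z : Fin (k + 1) → ℝ => ∏ i, f i (z i)),
    integral_fintype_prod_volume_eq_prod, Fin.prod_univ_succ]
  simp only [f, Fin.succ_ne_zero, if_true, if_false, polar_gauss, polar_abs_integral p hp]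
  simp

lemma polar_B (k : ℕ) (p : ℝ) (hp : 0 < p) :
    ∫ x : EuclideanSpace ℝ (Fin (k + 1)), ‖x‖ ^ p * Real.exp (-‖x‖ ^ 2) =
      Real.sqrt Real.pi ^ (k + 1) * Real.Gamma (((k + 1 : ℕ) + p) / 2) /
        Real.Gamma ((k + 1 : ℕ) / 2) := by
  have h := integral_rpow_mul_exp_neg_rpow (p := 2) (q := k + p) (by norm_num)
    (by have : (0 : ℝ) ≤ k := Nat.cast_nonneg k
        linarith)
  rw [integral_fun_norm_addHaar volume (fun r : ℝ => r ^ p * Real.exp (-r ^ 2))]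
  have h3 : ∫ y in Set.Ioi (0 : ℝ), y ^ (k + 1 - 1) • (y ^ p * Real.exp (-y ^ 2)) =
      1 / 2 * Real.Gamma ((k + p + 1) / 2) := by
    rw [← h]
    refine setIntegral_congr_fun measurableSet_Ioi fun y hy => ?_
    simp only [smul_eq_mul, Real.rpow_two, Nat.add_sub_cancel]
    rw [Real.rpow_add hy, Real.rpow_natCast, mul_assoc]
  have hG : Real.Gamma (((k + 1 : ℕ) : ℝ) / 2 + 1) =
      ((k + 1 : ℕ) : ℝ) / 2 * Real.Gamma (((k + 1 : ℕ) : ℝ) / 2) :=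
    Real.Gamma_add_one (by positivity)
  have hpos : 0 < Real.Gamma (((k + 1 : ℕ) : ℝ) / 2) := Real.Gamma_pos_of_pos (by positivity)
  simp only [finrank_euclideanSpace, Fintype.card_fin]
  rw [h3, Measure.real, EuclideanSpace.volume_ball]
  simp only [Fintype.card_fin, hG, ENNReal.ofReal_one, one_pow, one_mul]
  rw [ENNReal.toReal_ofReal (by positivity),
    show ((k : ℝ) + p + 1) / 2 = ((k + 1 : ℕ) + p) / 2 by push_cast; ring]
  simp only [nsmul_eq_mul, smul_eq_mul]
  have : ((k + 1 : ℕ) : ℝ) ≠ 0 := by positivity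
  field_simp

/-- The maximum over unit vectors `v` of `∑ i, |⟨v, u i⟩|^p` is at least `n · μ_{d,p}`. -/
theorem polarization_lower_bound (d n : ℕ) (hd : 1 ≤ d) (p : ℝ) (hp : 0 < p)
    (u : Fin n → EuclideanSpace ℝ (Fin d)) (hu : ∀ i, ‖u i‖ = 1) :
    ∃ v : EuclideanSpace ℝ (Fin d), ‖v‖ = 1 ∧
      (n : ℝ) * polarizationMu d p ≤ ∑ i, |⟪v, u i⟫| ^ p := by
  obtain ⟨k, rfl⟩ : ∃ k, d = k + 1 := ⟨d - 1, by omega⟩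
  have hc : Continuous fun v : EuclideanSpace ℝ (Fin (k + 1)) => ∑ i, |⟪v, u i⟫| ^ p := by
    refine continuous_finsetSum _ fun i _ => ?_
    exact (Continuous.abs (by fun_prop)).rpow_const fun _ => Or.inr hp.le
  obtain ⟨v, hv, hmax⟩ := (isCompact_sphere (0 : EuclideanSpace ℝ (Fin (k + 1))) 1).exists_isMaxOn
    ((NormedSpace.sphere_nonempty).2 zero_le_one) hc.continuousOn
  refine ⟨v, by simpa using hv, ?_⟩
  set M := ∑ i, |⟪v, u i⟫| ^ p with hM
  have hpt : ∀ x : EuclideanSpace ℝ (Fin (k + 1)), ∑ i, |⟪x, u i⟫| ^ p ≤ M * ‖x‖ ^ p := by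
    intro x
    by_cases hx : x = 0
    · simp [hx, Real.zero_rpow hp.ne']
    have hx' : 0 < ‖x‖ := norm_pos_iff.2 hx
    have h := hmax (show ‖x‖⁻¹ • x ∈ Metric.sphere (0 : EuclideanSpace ℝ (Fin (k + 1))) 1 by
      simp [norm_smul, hx'.ne'])
    have h : ∑ i, |⟪‖x‖⁻¹ • x, u i⟫| ^ p ≤ M := h
    calc ∑ i, |⟪x, u i⟫| ^ p = (∑ i, |⟪‖x‖⁻¹ • x, u i⟫| ^ p) * ‖x‖ ^ p := by
          rw [Finset.sum_mul]
          refine Finset.sum_congr rfl fun i _ => ?_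
          rw [← Real.mul_rpow (abs_nonneg _) hx'.le, real_inner_smul_left, abs_mul,
            abs_of_pos (inv_pos.2 hx')]
          congr 1
          field_simp
      _ ≤ _ := by gcongr
  have gp : 0 < Real.Gamma ((p + 1) / 2) := Real.Gamma_pos_of_pos (by positivity)
  have gd : 0 < Real.Gamma (((k + 1 : ℕ) : ℝ) / 2) := Real.Gamma_pos_of_pos (by positivity)
  have gdp : 0 < Real.Gamma ((((k + 1 : ℕ) : ℝ) + p) / 2) := Real.Gamma_pos_of_pos (by positivity)
  have hpi : 0 < Real.sqrt Real.pi := Real.sqrt_pos.2 Real.pi_pos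
  have iA : ∀ i, Integrable fun x : EuclideanSpace ℝ (Fin (k + 1)) =>
      |⟪x, u i⟫| ^ p * Real.exp (-‖x‖ ^ 2) := fun i =>
    Integrable.of_integral_ne_zero (by rw [polar_A k p hp _ (hu i)]; positivity)
  have iB : Integrable fun x : EuclideanSpace ℝ (Fin (k + 1)) =>
      ‖x‖ ^ p * Real.exp (-‖x‖ ^ 2) :=
    Integrable.of_integral_ne_zero (by rw [polar_B k p hp]; positivity)
  have hint : ∫ x : EuclideanSpace ℝ (Fin (k + 1)),
      ∑ i, |⟪x, u i⟫| ^ p * Real.exp (-‖x‖ ^ 2) ≤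
      ∫ x : EuclideanSpace ℝ (Fin (k + 1)), M * (‖x‖ ^ p * Real.exp (-‖x‖ ^ 2)) := by
    refine integral_mono (integrable_finsetSum _ fun i _ => iA i) (iB.const_mul M) fun x => ?_
    simp only
    rw [← Finset.sum_mul, ← mul_assoc]
    exact mul_le_mul_of_nonneg_right (hpt x) (Real.exp_pos _).le
  rw [integral_finsetSum _ fun i _ => iA i, integral_const_mul, polar_B k p hp] at hint
  simp only [polar_A k p hp _ (hu _), Finset.sum_const, Finset.card_univ, Fintype.card_fin,
    nsmul_eq_mul] at hint
  have hB : 0 < Real.sqrt Real.pi ^ (k + 1) * Real.Gamma (((k + 1 : ℕ) + p) / 2) /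
        Real.Gamma ((k + 1 : ℕ) / 2) := by positivity
  refine le_of_mul_le_mul_right (le_trans (le_of_eq ?_) hint) hB
  unfold polarizationMu
  field_simp
  ring
end

section
/- For every real p ≥ 1 and every constant c > 0, there exists a constant C = C(p, c) such that for all d ≥ 2 and all n ≥ C · d^{1+p} · log d, there exists a sequence ω_n of n unit vectors in ℝ^d whose ℓ_p-polarization satisfies M^p(ω_n) ≤ n·μ_{d,p} + c·n·d^{−p/2}. -/
open scoped RealInnerProductSpace

open MeasureTheory Set

theorem pol_polar (d : ℕ) (hd : 2 ≤ d) (q : ℝ) (hq : 0 ≤ q) (v : EuclideanSpace ℝ (Fin d)) :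
    ∫ x : EuclideanSpace ℝ (Fin d), |⟪v, x⟫| ^ q * Real.exp (-‖x‖ ^ 2) =
    (∫ w, |⟪v, (w : EuclideanSpace ℝ (Fin d))⟫| ^ q
      ∂(volume : Measure (EuclideanSpace ℝ (Fin d))).toSphere) *
      (1 / 2 * Real.Gamma ((d + q) / 2)) := by
  let E := EuclideanSpace ℝ (Fin d)
  have hfr : Module.finrank ℝ E = d := by simp [E]
  have : Nontrivial E := Module.nontrivial_of_finrank_pos (R := ℝ) (by omega)
  let μ : Measure E := volume
  let F : E → ℝ := fun x => |⟪v, x⟫| ^ q * Real.exp (-‖x‖ ^ 2)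
  calc ∫ x : E, F x = ∫ x : ({(0)}ᶜ : Set E), F x.1 ∂(μ.comap (↑)) := by
        rw [integral_subtype_comap (measurableSet_singleton _).compl F, restrict_compl_singleton]
    _ = ∫ x, F (x.2.1 • x.1.1) ∂μ.toSphere.prod (.volumeIoiPow (Module.finrank ℝ E - 1)) := by
        rw [← μ.measurePreserving_homeomorphUnitSphereProd.integral_comp
          (Homeomorph.measurableEmbedding _) (fun x => F (x.2.1 • x.1.1))]
        refine integral_congr_ae (.of_forall fun x => ?_)
        have hx : ‖x.1‖ ≠ 0 := norm_ne_zero_iff.2 x.2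
        simp [smul_smul, hx]
    _ = ∫ x : (Metric.sphere (0 : E) 1) × Ioi (0 : ℝ), (|⟪v, x.1.1⟫| ^ q) * (x.2.1 ^ q * Real.exp (-x.2.1 ^ 2))
          ∂μ.toSphere.prod (.volumeIoiPow (Module.finrank ℝ E - 1)) := by
        refine integral_congr_ae (.of_forall fun x => ?_)
        have h2 : (0 : ℝ) < x.2.1 := x.2.2
        simp only [F, inner_smul_right, abs_mul, norm_smul, Real.norm_eq_abs, abs_of_pos h2]
        rw [Real.mul_rpow h2.le (abs_nonneg _), norm_eq_of_mem_sphere]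
        simp only [mul_one]
        ring
    _ = (∫ w, |⟪v, (w : E)⟫| ^ q ∂μ.toSphere) *
          ∫ r : Ioi (0 : ℝ), (r.1 ^ q * Real.exp (-r.1 ^ 2)) ∂(.volumeIoiPow (Module.finrank ℝ E - 1)) :=
        integral_prod_mul (fun w : Metric.sphere (0 : E) 1 => |⟪v, (w : E)⟫| ^ q)
          (fun r : Ioi (0 : ℝ) => (r.1 ^ q * Real.exp (-r.1 ^ 2)))
    _ = _ := by
      congr 1
      simp only [Measure.volumeIoiPow, ENNReal.ofReal]
      rw [integral_withDensity_eq_integral_smul,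
        integral_subtype_comap measurableSet_Ioi
          fun a : ℝ ↦ Real.toNNReal (a ^ (Module.finrank ℝ E - 1)) • (a ^ q * Real.exp (-a ^ 2))]
      · have := integral_rpow_mul_exp_neg_rpow (p := 2) (q := d - 1 + q) (by norm_num)
          (by have : (2:ℝ) ≤ d := by exact_mod_cast hd
              linarith)
        rw [show ((d:ℝ) - 1 + q + 1) / 2 = (d + q) / 2 by ring] at this
        rw [← this]
        refine setIntegral_congr_fun measurableSet_Ioi fun x hx ↦ ?_
        have hx' : 0 < x := hx
        rw [NNReal.smul_def, Real.coe_toNNReal _ (pow_nonneg hx'.le _), hfr, smul_eq_mul, ← mul_assoc,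
          ← Real.rpow_natCast x (d - 1), ← Real.rpow_add hx', Nat.cast_sub (by omega)]
        simp
      · exact (measurable_subtype_coe.pow_const _).real_toNNReal

theorem pol_gauss (d : ℕ) (hd : 2 ≤ d) (q : ℝ) (hq : 0 ≤ q) (v : EuclideanSpace ℝ (Fin d))
    (hv : ‖v‖ = 1) :
    ∫ x : EuclideanSpace ℝ (Fin d), |⟪v, x⟫| ^ q * Real.exp (-‖x‖ ^ 2) =
     Real.Gamma ((q + 1) / 2) * (Real.sqrt Real.pi) ^ (d - 1) := by
  obtain ⟨e, rfl⟩ : ∃ e, d = e + 1 := ⟨d - 1, by omega⟩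
  have ho : Orthonormal ℝ (({0} : Set (Fin (e+1))).domRestrict (fun _ => v)) := by
    refine ⟨fun i => hv, fun i j hij => (hij (Subsingleton.elim _ _)).elim⟩
  obtain ⟨b, hb⟩ := ho.exists_orthonormalBasis_extension_of_card_eq (by simp)
  have hb0 : b 0 = v := hb 0 rfl
  have h1 : ∀ x, |⟪v, x⟫| ^ q * Real.exp (-‖x‖ ^ 2) =
      (fun y : EuclideanSpace ℝ (Fin (e+1)) => |y 0| ^ q * Real.exp (-‖y‖ ^ 2)) (b.repr x) := by
    intro x
    simp [b.repr_apply_apply, hb0]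
  simp_rw [h1]
  rw [b.measurePreserving_repr.integral_comp b.repr.toHomeomorph.measurableEmbedding
    (fun y : EuclideanSpace ℝ (Fin (e+1)) => |y 0| ^ q * Real.exp (-‖y‖ ^ 2)),
    ← (PiLp.volume_preserving_toLp (Fin (e+1))).integral_comp
      (MeasurableEquiv.toLp 2 _).measurableEmbedding]
  have h2 : ∀ y : Fin (e+1) → ℝ, |(WithLp.toLp 2 y) 0| ^ q * Real.exp (-‖WithLp.toLp 2 y‖ ^ 2) =
      ∏ i, (fun (i : Fin (e+1)) (t : ℝ) => (if i = 0 then |t| ^ q else 1) * Real.exp (-t ^ 2)) i (y i) := by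
    intro y
    rw [EuclideanSpace.norm_sq_eq]
    simp only [Finset.prod_mul_distrib, ← Real.exp_sum, Finset.prod_ite_eq', Finset.sum_neg_distrib]
    simp
  rw [integral_congr_ae (.of_forall h2)]
  rw [integral_fintype_prod_volume_eq_prod (fun (i : Fin (e+1)) (t : ℝ) =>
    (if i = 0 then |t| ^ q else 1) * Real.exp (-t ^ 2)), Fin.prod_univ_succ]
  congr 1
  · have := integral_comp_abs (f := fun t : ℝ => t ^ q * Real.exp (-t ^ 2))
    simp only [if_true, sq_abs] at this ⊢
    rw [this]
    have := integral_rpow_mul_exp_neg_rpow (p := 2) (q := q) (by norm_num) (by linarith)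
    simp only [Real.rpow_two] at this
    rw [this]; ring
  · have := integral_gaussian 1
    simp only [neg_mul, one_mul, div_one] at this
    simp [Fin.succ_ne_zero, this]

theorem lip (p : ℝ) (hp : 1 ≤ p) (a b : ℝ) (ha : |a| ≤ 1) :
    |a| ^ p ≤ |b| ^ p + p * |a - b| := by
  rcases le_or_gt |a| |b| with h | h
  · have := Real.rpow_le_rpow (abs_nonneg a) h (by linarith : 0 ≤ p)
    have : 0 ≤ p * |a - b| := by positivity
    linarith
  · have ha0 : 0 < |a| := (abs_nonneg b).trans_lt h
    have h1 := one_add_mul_self_le_rpow_one_add (s := |b| / |a| - 1)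
      (by have : 0 ≤ |b| / |a| := by positivity
          linarith) hp
    rw [add_sub_cancel, Real.div_rpow (abs_nonneg _) ha0.le] at h1
    have hpos : 0 < |a| ^ p := Real.rpow_pos_of_pos ha0 _
    rw [le_div_iff₀ hpos] at h1
    have h3 : |a| ^ p = |a| ^ (p - 1) * |a| := by
      rw [Real.rpow_sub_one ha0.ne']; field_simp
    have h4 : |a| ^ (p - 1) ≤ 1 := Real.rpow_le_one ha0.le ha (by linarith)
    have h5 : |a| ^ p * (|b| / |a| - 1) = - (|a| ^ (p - 1) * (|a| - |b|)) := by
      rw [h3]; field_simp; ring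
    have h6 : |a| ^ (p - 1) * (|a| - |b|) ≤ 1 * |a - b| := by
      apply mul_le_mul h4 (abs_sub_abs_le_abs_sub a b) (by linarith) (by norm_num)
    nlinarith

theorem pol_mean (d : ℕ) (hd : 2 ≤ d) (p : ℝ) (hp : 0 ≤ p) :
    ∃ P : Measure (Metric.sphere (0 : EuclideanSpace ℝ (Fin d)) 1), IsProbabilityMeasure P ∧
      ∀ v : EuclideanSpace ℝ (Fin d), ‖v‖ = 1 →
        ∫ w, |⟪v, (w : EuclideanSpace ℝ (Fin d))⟫| ^ p ∂P = polarizationMu d p := by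
  have : Nontrivial (EuclideanSpace ℝ (Fin d)) :=
    Module.nontrivial_of_finrank_pos (R := ℝ) (by simp; omega)
  set σ := (volume : Measure (EuclideanSpace ℝ (Fin d))).toSphere with hσ
  have : NeZero σ := ⟨Measure.toSphere_ne_zero _⟩
  refine ⟨(σ univ)⁻¹ • σ, inferInstance, fun v hv => ?_⟩
  have h1 := pol_polar d hd p hp v
  rw [pol_gauss d hd p hp v hv] at h1
  have h0 := pol_polar d hd 0 le_rfl v
  rw [pol_gauss d hd 0 le_rfl v hv] at h0
  rw [← hσ] at h1 h0
  simp only [Real.rpow_zero, integral_const, smul_eq_mul, mul_one, add_zero, zero_add,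
    Real.Gamma_one_half_eq] at h0
  rw [integral_smul_measure, ENNReal.toReal_inv, ← measureReal_def, smul_eq_mul, polarizationMu]
  have hd' : (2:ℝ) ≤ d := by exact_mod_cast hd
  have g1 : 0 < Real.Gamma (d / 2) := Real.Gamma_pos_of_pos (by linarith)
  have g2 : 0 < Real.Gamma ((d + p) / 2) := Real.Gamma_pos_of_pos (by linarith)
  have g3 : 0 < Real.sqrt Real.pi := Real.sqrt_pos.2 Real.pi_pos
  have g4 : 0 < (Real.sqrt Real.pi) ^ (d - 1) := by positivity
  have hs : σ.real univ ≠ 0 := by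
    intro h; rw [h, zero_mul] at h0; exact absurd h0 (mul_pos g3 g4).ne'
  rw [eq_div_iff (by positivity), inv_mul_eq_div, div_mul_eq_mul_div, div_eq_iff hs]
  refine mul_right_cancel₀ g4.ne' ?_
  linear_combination (-√Real.pi * √Real.pi ^ (d-1) * 2) * h1 + (2 * Real.Gamma ((p+1)/2) * √Real.pi ^ (d-1)) * h0

theorem pol_hoeffding {S : Type*} [MeasurableSpace S] (P : Measure S) [IsProbabilityMeasure P]
    (f : S → ℝ) (hf : Measurable f) (hb : ∀ s, f s ∈ Icc (0:ℝ) 1) (n : ℕ) (hn : 0 < n)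
    (t : ℝ) (ht : 0 ≤ t) :
    (Measure.pi (fun _ : Fin n => P)).real
      {ω | n * (∫ s, f s ∂P) + n * t ≤ ∑ i, f (ω i)} ≤ Real.exp (-2 * n * t ^ 2) := by
  have hi : ProbabilityTheory.iIndepFun (fun (i : Fin n) (ω : Fin n → S) => f (ω i) - ∫ s, f s ∂P)
      (Measure.pi (fun _ : Fin n => P)) :=
    ProbabilityTheory.iIndepFun_pi (X := fun (_ : Fin n) s => f s - ∫ s, f s ∂P)
      (fun i => (hf.sub_const _).aemeasurable)
  have hsub : ∀ i ∈ (Finset.univ : Finset (Fin n)), ProbabilityTheory.HasSubgaussianMGF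
      (fun ω : Fin n → S => f (ω i) - ∫ s, f s ∂P) ((‖(1:ℝ) - 0‖₊ / 2) ^ 2)
      (Measure.pi (fun _ : Fin n => P)) := by
    intro i _
    have := ProbabilityTheory.hasSubgaussianMGF_of_mem_Icc (X := fun ω : Fin n → S => f (ω i))
      (μ := Measure.pi (fun _ : Fin n => P)) (a := 0) (b := 1)
      (hf.comp (measurable_pi_apply i)).aemeasurable (.of_forall fun ω => hb _)
    have he : ∫ ω : Fin n → S, f (ω i) ∂(Measure.pi (fun _ : Fin n => P)) = ∫ s, f s ∂P :=
      integral_comp_eval (μ := fun _ : Fin n => P) (i := i) hf.aestronglyMeasurable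
    rwa [he] at this
  have := ProbabilityTheory.HasSubgaussianMGF.measure_sum_ge_le_of_iIndepFun hi hsub
    (ε := n * t) (by positivity)
  refine (le_of_eq ?_).trans (this.trans (le_of_eq ?_))
  · congr 1; ext ω
    simp only [mem_ofPred_eq, Finset.sum_sub_distrib, Finset.sum_const, Finset.card_univ,
      Fintype.card_fin, nsmul_eq_mul]
    constructor <;> intro h <;> linarith
  · congr 1
    have : (n:ℝ) ≠ 0 := by positivity
    simp
    field_simp

theorem pol_core (d : ℕ) (hd : 2 ≤ d) (p : ℝ) (hp : 1 ≤ p) (n m : ℕ) (hn : 0 < n) (hm : 0 < m)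
    (t : ℝ) (ht : 0 ≤ t) (hlt : ((2 * m + 1 : ℕ) : ℝ) ^ d * Real.exp (-2 * n * t ^ 2) < 1) :
    ∃ u : Fin n → EuclideanSpace ℝ (Fin d), (∀ i, ‖u i‖ = 1) ∧
        ∀ v : EuclideanSpace ℝ (Fin d), ‖v‖ = 1 →
          ∑ i, |⟪v, u i⟫| ^ p ≤ n * polarizationMu d p + n * t + n * (p * (d / m)) := by
  obtain ⟨P, hP, hmean⟩ := pol_mean d hd p (by linarith)
  let E := EuclideanSpace ℝ (Fin d)
  have hm' : (0:ℝ) < m := by exact_mod_cast hm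
  have hcoord : ∀ (v : E) i, ‖v‖ = 1 → |v i| ≤ 1 := by
    intro v i hv
    have := PiLp.norm_apply_le v i
    rwa [hv] at this
  let κ : Metric.sphere (0 : E) 1 → (Fin d → Fin (2 * m + 1)) := fun v i =>
    ⟨⌊(v.1 i + 1) * m⌋₊, by
      have h1 := (abs_le.1 (hcoord v.1 i (norm_eq_of_mem_sphere v))).2
      have : (v.1 i + 1) * m ≤ (2 * m : ℕ) := by push_cast; nlinarith
      exact Nat.lt_succ_of_le (Nat.floor_le_of_le this)⟩
  have hκ : ∀ v w, κ v = κ w → ‖v.1 - w.1‖ ≤ d / m := by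
    intro v w h
    have hi : ∀ i, |v.1 i - w.1 i| ≤ 1 / m := by
      intro i
      have hh : ⌊(v.1 i + 1) * m⌋₊ = ⌊(w.1 i + 1) * m⌋₊ := congrArg Fin.val (congrFun h i)
      have a1 := (abs_le.1 (hcoord v.1 i (norm_eq_of_mem_sphere v))).1
      have a2 := (abs_le.1 (hcoord w.1 i (norm_eq_of_mem_sphere w))).1
      have b1 := Nat.floor_le (show 0 ≤ (v.1 i + 1) * m from mul_nonneg (by linarith) hm'.le)
      have b2 := Nat.floor_le (show 0 ≤ (w.1 i + 1) * m from mul_nonneg (by linarith) hm'.le)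
      have c1 := Nat.lt_floor_add_one ((v.1 i + 1) * m)
      have c2 := Nat.lt_floor_add_one ((w.1 i + 1) * m)
      rw [hh] at b1 c1
      rw [le_div_iff₀ hm']
      have e : |v.1 i - w.1 i| * m = |(v.1 i - w.1 i) * m| := by rw [abs_mul, abs_of_pos hm']
      rw [e]
      exact abs_le.2 ⟨by linarith, by linarith⟩
    have h1m : (0:ℝ) ≤ d / m := by positivity
    rw [EuclideanSpace.norm_eq]
    refine Real.sqrt_le_iff.2 ⟨h1m, ?_⟩
    calc ∑ i, ‖(v.1 - w.1) i‖ ^ 2 ≤ ∑ i : Fin d, (1 / (m:ℝ)) ^ 2 := by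
          refine Finset.sum_le_sum fun i _ => ?_
          have := hi i
          exact pow_le_pow_left₀ (norm_nonneg _) this 2
      _ = d / m ^ 2 := by simp; ring
      _ ≤ _ := by
          rw [div_pow]
          gcongr
          have : (1:ℝ) ≤ d := by exact_mod_cast (by omega : 1 ≤ d)
          nlinarith
  classical
  have hne : Nonempty (Metric.sphere (0 : E) 1) := by
    by_contra h
    rw [not_nonempty_iff] at h
    have := hP.measure_univ
    rw [univ_eq_empty_iff.2 h] at this
    simp at this
  let g : (Fin d → Fin (2 * m + 1)) → Metric.sphere (0 : E) 1 := Function.invFun κ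
  let Q := Measure.pi (fun _ : Fin n => P)
  let f : Metric.sphere (0 : E) 1 → Metric.sphere (0 : E) 1 → ℝ :=
    fun v w => |⟪v.1, w.1⟫| ^ p
  let B : (Fin d → Fin (2 * m + 1)) → Set (Fin n → Metric.sphere (0 : E) 1) := fun k =>
    {ω | n * polarizationMu d p + n * t ≤ ∑ i, f (g k) (ω i)}
  have hin : ∀ v w : Metric.sphere (0 : E) 1, |⟪v.1, w.1⟫| ≤ 1 := by
    intro v w
    have := abs_real_inner_le_norm v.1 w.1
    simpa using this
  have hB : ∀ k, Q.real (B k) ≤ Real.exp (-2 * n * t ^ 2) := by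
    intro k
    have := pol_hoeffding P (f (g k)) (by
      have : Continuous (f (g k)) := by
        have h0 : Continuous fun w : Metric.sphere (0 : E) 1 => |⟪(g k).1, w.1⟫| := by fun_prop
        exact h0.rpow_const (fun _ => Or.inr (by linarith))
      exact this.measurable)
      (fun s => ⟨by positivity, Real.rpow_le_one (abs_nonneg _) (hin _ _) (by linarith)⟩) n hn t ht
    rwa [hmean (g k).1 (norm_eq_of_mem_sphere _)] at this
  have hU : Q.real (⋃ k, B k) < 1 := by
    refine (measureReal_iUnion_fintype_le B).trans_lt ?_
    refine (Finset.sum_le_sum fun k _ => hB k).trans_lt ?_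
    simpa using hlt
  obtain ⟨ω, hω⟩ : ∃ ω, ω ∉ ⋃ k, B k := by
    by_contra! h
    rw [eq_univ_of_forall h] at hU
    simp [Q] at hU
  refine ⟨fun i => (ω i).1, fun i => norm_eq_of_mem_sphere _, fun v hv => ?_⟩
  let v' : Metric.sphere (0 : E) 1 := ⟨v, by simpa using hv⟩
  have hgk : κ (g (κ v')) = κ v' := Function.invFun_eq ⟨v', rfl⟩
  have hdist := hκ _ _ hgk.symm
  have hnot : ω ∉ B (κ v') := fun h => hω (mem_iUnion.2 ⟨_, h⟩)
  simp only [B, mem_ofPred_eq, not_le, f] at hnot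
  have hs : ∀ i, |⟪v, (ω i).1⟫| ^ p ≤ |⟪(g (κ v')).1, (ω i).1⟫| ^ p + p * (d / m) := by
    intro i
    refine (lip p hp _ ⟪(g (κ v')).1, (ω i).1⟫ (hin v' (ω i))).trans ?_
    gcongr
    rw [← inner_sub_left]
    refine (abs_real_inner_le_norm _ _).trans ?_
    rw [norm_eq_of_mem_sphere, mul_one]
    exact hdist
  refine (Finset.sum_le_sum fun i _ => hs i).trans ?_
  rw [Finset.sum_add_distrib]
  simp only [Finset.sum_const, Finset.card_univ, Fintype.card_fin, nsmul_eq_mul]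
  linarith

/-- For `p ≥ 1` and `c > 0` there is `C = C(p,c)` such that for all `d ≥ 2` and
`n ≥ C · d^(1+p) · log d`, some configuration of `n` unit vectors in `ℝ^d` has
`ℓ_p`-polarization at most `n·μ_{d,p} + c·n·d^(-p/2)`. -/
theorem polarization_upper_bound_many_points (p : ℝ) (hp : 1 ≤ p) (c : ℝ) (hc : 0 < c) :
    ∃ C : ℝ, ∀ d n : ℕ, 2 ≤ d → C * (d : ℝ) ^ (1 + p) * Real.log d ≤ n →
      ∃ u : Fin n → EuclideanSpace ℝ (Fin d), (∀ i, ‖u i‖ = 1) ∧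
        ∀ v : EuclideanSpace ℝ (Fin d), ‖v‖ = 1 →
          ∑ i, |⟪v, u i⟫| ^ p ≤ n * polarizationMu d p + c * n * (d : ℝ) ^ (-(p / 2)) := by
  set K : ℝ := 4 * p / c + 3 with hK
  have hK1 : 1 ≤ K := by
    have : 0 < 4 * p / c := by positivity
    linarith
  have hl2 : 0 < Real.log 2 := Real.log_pos (by norm_num)
  have hlK : 0 ≤ Real.log K := Real.log_nonneg hK1
  set A : ℝ := Real.log K / Real.log 2 + 2 + p with hA
  have hA0 : 0 < A := by positivity
  refine ⟨2 / c ^ 2 * A, fun d n hd hn => ?_⟩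
  have hd2 : (2:ℝ) ≤ d := by exact_mod_cast hd
  have hd0 : (0:ℝ) < d := by linarith
  have hld : Real.log 2 ≤ Real.log d := Real.log_le_log (by norm_num) hd2
  have hld0 : 0 < Real.log d := hl2.trans_le hld
  have hn0 : 0 < n := by
    have : (0:ℝ) < n := lt_of_lt_of_le (by positivity) hn
    exact_mod_cast this
  set D : ℝ := (d:ℝ) ^ (1 + p / 2) with hD
  have hD1 : 1 ≤ D := Real.one_le_rpow (by linarith) (by linarith)
  set y : ℝ := 2 * p * D / c with hy
  have hy0 : 0 < y := by positivity
  set m := ⌈y⌉₊ with hm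
  have hm0 : 0 < m := Nat.ceil_pos.2 hy0
  have hym : y ≤ m := Nat.le_ceil y
  have hmy : (m:ℝ) < y + 1 := Nat.ceil_lt_add_one hy0.le
  set T : ℝ := (d:ℝ) ^ (-(p / 2)) with hT
  have hT0 : 0 < T := by positivity
  have hDT : D * T = d := by
    rw [hD, hT, ← Real.rpow_add hd0]; simp
  have hlogm : Real.log ((2 * m + 1 : ℕ) : ℝ) < A * Real.log d := by
    have h1 : ((2 * m + 1 : ℕ) : ℝ) ≤ K * D := by
      push_cast
      have : K * D = 2 * y + 3 * D := by rw [hK, hy]; ring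
      linarith
    have h2 := Real.log_le_log (by positivity) h1
    rw [Real.log_mul (by positivity) (by positivity), hD, Real.log_rpow hd0] at h2
    have h3 : Real.log K ≤ Real.log K / Real.log 2 * Real.log d := by
      rw [div_mul_eq_mul_div, le_div_iff₀ hl2]; gcongr
    have : 0 < (1 + p / 2) * Real.log d := by positivity
    rw [hA]
    nlinarith
  obtain ⟨u, hu, hv⟩ := pol_core d hd p hp n m hn0 hm0 (c / 2 * T) (by positivity) (by
    have hMpos : (0:ℝ) < ((2 * m + 1 : ℕ) : ℝ) := by positivity
    rw [← Real.exp_log hMpos, ← Real.exp_nat_mul, ← Real.exp_add, Real.exp_lt_one_iff]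
    have hTT : T ^ 2 * (d:ℝ) ^ (1 + p) = d := by
      rw [hT, ← Real.rpow_natCast, ← Real.rpow_mul hd0.le, ← Real.rpow_add hd0]
      have : -(p / 2) * ((2:ℕ):ℝ) + (1 + p) = 1 := by push_cast; ring
      rw [this, Real.rpow_one]
    have h5 : (d:ℝ) * (A * Real.log d) ≤ 2 * n * (c / 2 * T) ^ 2 := by
      have := mul_le_mul_of_nonneg_left hn (show 0 ≤ c ^ 2 / 2 * T ^ 2 by positivity)
      have e : c ^ 2 / 2 * T ^ 2 * (2 / c ^ 2 * A * (d:ℝ) ^ (1 + p) * Real.log d)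
          = (T ^ 2 * (d:ℝ) ^ (1 + p)) * (A * Real.log d) := by field_simp
      rw [e, hTT] at this
      linarith
    have h6 := mul_lt_mul_of_pos_left hlogm hd0
    linarith)
  refine ⟨u, hu, fun v h => (hv v h).trans ?_⟩
  have h7 : p * (d / m) ≤ c / 2 * T := by
    have hm1 : (0:ℝ) < m := by exact_mod_cast hm0
    rw [← mul_div_assoc, div_le_iff₀ hm1, ← hDT]
    have e : p * (D * T) = c / 2 * T * y := by rw [hy]; field_simp
    rw [e]; gcongr
  have := mul_le_mul_of_nonneg_left h7 (Nat.cast_nonneg n : (0:ℝ) ≤ n)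
  linarith
end

section
/- Let 0 < p ≤ 2, let H and H^⊥ be two orthogonal d-dimensional linear subspaces of ℝ^{2d}, let ω_n be a sequence of n unit vectors lying in H and ω_n^⊥ a sequence of n unit vectors lying in H^⊥, and suppose M^p(ω_n) ≤ m and M^p(ω_n^⊥) ≤ m, where the polarization maxima are taken over all unit vectors of ℝ^{2d}. Then the concatenated sequence ω_{2n} = ω_n ∪ ω_n^⊥ of 2n unit vectors in ℝ^{2d} satisfies M^p(ω_{2n}) ≤ 2^{1 − p/2} · m. -/
open scoped RealInnerProductSpace

theorem polarization_scale {E : Type*} [NormedAddCommGroup E] [InnerProductSpace ℝ E] {n : ℕ}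
    (p : ℝ) (hp0 : 0 < p) (u : Fin n → E) (m : ℝ)
    (hum : ∀ v : E, ‖v‖ = 1 → ∑ i, |⟪v, u i⟫| ^ p ≤ m) (a : E) :
    ∑ i, |⟪a, u i⟫| ^ p ≤ ‖a‖ ^ p * m := by
  by_cases ha : a = 0
  · subst ha
    simp [Real.zero_rpow hp0.ne']
  · have hn : 0 < ‖a‖ := norm_pos_iff.mpr ha
    have h1 : ‖(‖a‖⁻¹ • a)‖ = 1 := by
      rw [norm_smul, norm_inv, norm_norm, inv_mul_cancel₀ hn.ne']
    have h2 := hum _ h1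
    have h3 : ∑ i, |⟪a, u i⟫| ^ p = ‖a‖ ^ p * ∑ i, |⟪‖a‖⁻¹ • a, u i⟫| ^ p := by
      rw [Finset.mul_sum]
      refine Finset.sum_congr rfl fun i _ => ?_
      rw [← Real.mul_rpow hn.le (abs_nonneg _), real_inner_smul_left, abs_mul, abs_inv, abs_norm,
        mul_inv_cancel_left₀ hn.ne']
    rw [h3]
    exact mul_le_mul_of_nonneg_left h2 (by positivity)

theorem rpow_add_rpow_le_of_sq (p : ℝ) (hp0 : 0 < p) (hp2 : p ≤ 2) (x y : ℝ) (hx : 0 ≤ x)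
    (hy : 0 ≤ y) (h : x ^ 2 + y ^ 2 = 1) : x ^ p + y ^ p ≤ 2 ^ (1 - p / 2) := by
  have hc := (Real.concaveOn_rpow (p := p / 2) (by linarith) (by linarith)).2
    (Set.mem_Ici.mpr (sq_nonneg x)) (Set.mem_Ici.mpr (sq_nonneg y))
    (by norm_num : (0 : ℝ) ≤ 1 / 2) (by norm_num : (0 : ℝ) ≤ 1 / 2) (by norm_num)
  have e : ∀ z : ℝ, 0 ≤ z → (z ^ 2) ^ (p / 2) = z ^ p := by
    intro z hz
    rw [← Real.rpow_natCast, ← Real.rpow_mul hz]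
    congr 1
    push_cast
    ring
  simp only [smul_eq_mul] at hc
  rw [e x hx, e y hy, ← mul_add, ← mul_add, h, mul_one, one_div,
    Real.inv_rpow (by norm_num : (0 : ℝ) ≤ 2)] at hc
  rw [Real.rpow_sub (by norm_num), Real.rpow_one, div_eq_mul_inv]
  linarith

/-- Doubling construction: if `ω_n ⊂ H` and `ω_n^⊥ ⊂ H^⊥` are `n`-element sets of unit
vectors in orthogonal `d`-dimensional subspaces of `ℝ^{2d}`, each of `ℓ_p`-polarization at
most `m`, then their union has `ℓ_p`-polarization at most `2^(1-p/2) · m`. -/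
theorem polarization_doubling (d n : ℕ) (p : ℝ) (hp0 : 0 < p) (hp2 : p ≤ 2)
    (H K : Submodule ℝ (EuclideanSpace ℝ (Fin (2 * d))))
    (hH : Module.finrank ℝ H = d) (hK : Module.finrank ℝ K = d)
    (hHK : ∀ x ∈ H, ∀ y ∈ K, ⟪x, y⟫ = 0)
    (u w : Fin n → EuclideanSpace ℝ (Fin (2 * d)))
    (huH : ∀ i, u i ∈ H) (hwK : ∀ i, w i ∈ K)
    (hu : ∀ i, ‖u i‖ = 1) (hw : ∀ i, ‖w i‖ = 1) (m : ℝ)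
    (hum : ∀ v : EuclideanSpace ℝ (Fin (2 * d)), ‖v‖ = 1 → ∑ i, |⟪v, u i⟫| ^ p ≤ m)
    (hwm : ∀ v : EuclideanSpace ℝ (Fin (2 * d)), ‖v‖ = 1 → ∑ i, |⟪v, w i⟫| ^ p ≤ m) :
    ∀ v : EuclideanSpace ℝ (Fin (2 * d)), ‖v‖ = 1 →
      (∑ i, |⟪v, u i⟫| ^ p) + ∑ i, |⟪v, w i⟫| ^ p ≤ 2 ^ (1 - p / 2) * m := by
  intro v hv
  have hm : 0 ≤ m := le_trans (Finset.sum_nonneg fun i _ => by positivity) (hum v hv)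
  set a := H.starProjection v with ha
  have haH : a ∈ H := H.starProjection_apply_mem v
  have hbH : v - a ∈ Hᗮ := H.sub_starProjection_mem_orthogonal v
  have h1 : ∀ i, ⟪v, u i⟫ = ⟪a, u i⟫ := fun i => by
    have := Submodule.inner_left_of_mem_orthogonal (huH i) hbH
    rw [inner_sub_left] at this
    linarith
  have h2 : ∀ i, ⟪v, w i⟫ = ⟪v - a, w i⟫ := fun i => by
    rw [inner_sub_left, hHK a haH (w i) (hwK i), sub_zero]
  have h3 : ‖a‖ ^ 2 + ‖v - a‖ ^ 2 = 1 := by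
    have := norm_add_sq_real a (v - a)
    rw [Submodule.inner_right_of_mem_orthogonal haH hbH, add_sub_cancel, hv] at this
    linarith
  simp only [h1, h2]
  have h4 := polarization_scale p hp0 u m hum a
  have h5 := polarization_scale p hp0 w m hwm (v - a)
  have h6 := mul_le_mul_of_nonneg_right
    (rpow_add_rpow_le_of_sq p hp0 hp2 _ _ (norm_nonneg a) (norm_nonneg (v - a)) h3) hm
  linarith
end

section
/- For every real p with 0 < p ≤ 2 and all integers n ≥ d ≥ 1, there exists a sequence ω_n of n unit vectors in ℝ^d whose ℓ_p-polarization satisfies M^p(ω_n) ≤ 2^{p/2} · n · d^{−p/2}. -/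
open scoped RealInnerProductSpace

/-- Each residue class modulo `d` has at most `n / d + 1` members below `n`. -/
lemma card_residue_le (d n : ℕ) (hd : 0 < d) (j : Fin d) :
    (Finset.univ.filter (fun i : Fin n => (⟨i.1 % d, Nat.mod_lt _ hd⟩ : Fin d) = j)).card
      ≤ n / d + 1 := by
  rw [← Finset.card_range (n / d + 1)]
  apply Finset.card_le_card_of_injOn (fun i : Fin n => i.1 / d)
  · intro i _
    have : i.1 / d ≤ n / d := Nat.div_le_div_right i.2.le
    simp only [Finset.coe_range, Set.mem_Iio]
    omega
  · intro a ha b hb hab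
    simp only [Finset.coe_filter, Finset.mem_univ, true_and, Set.mem_setOf_eq] at ha hb
    have h1 : a.1 % d = b.1 % d := by
      have := ha.trans hb.symm
      simpa using this
    have h2 : a.1 / d = b.1 / d := hab
    apply Fin.ext
    rw [← Nat.div_add_mod a.1 d, ← Nat.div_add_mod b.1 d, h1, h2]

/-- For `0 < p ≤ 2` and `n ≥ d ≥ 1` there is a configuration of `n` unit vectors in `ℝ^d`
whose `ℓ_p`-polarization is at most `2^(p/2) · n · d^(-p/2)`. -/
theorem polarization_upper_bound (d n : ℕ) (hd : 1 ≤ d) (hn : d ≤ n)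
    (p : ℝ) (hp0 : 0 < p) (hp2 : p ≤ 2) :
    ∃ u : Fin n → EuclideanSpace ℝ (Fin d), (∀ i, ‖u i‖ = 1) ∧
      ∀ v : EuclideanSpace ℝ (Fin d), ‖v‖ = 1 →
        ∑ i, |⟪v, u i⟫| ^ p ≤ 2 ^ (p / 2) * n * (d : ℝ) ^ (-(p / 2)) := by
  have hd0 : (0 : ℝ) < d := by exact_mod_cast hd
  let r : Fin n → Fin d := fun i => ⟨i.1 % d, Nat.mod_lt _ hd⟩
  refine ⟨fun i => EuclideanSpace.single (r i) 1, fun i => by simp, fun v hv => ?_⟩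
  have hin : ∀ i, ⟪v, EuclideanSpace.single (r i) (1 : ℝ)⟫ = v (r i) := fun i => by
    simp [EuclideanSpace.inner_single_right]
  simp only [hin]
  have hcount : ((n / d + 1 : ℕ) : ℝ) ≤ 2 * n / d := by
    rw [le_div_iff₀ hd0]
    have h1 : n / d * d ≤ n := Nat.div_mul_le_self n d
    have : (n / d + 1) * d ≤ 2 * n := by nlinarith
    exact_mod_cast this
  have hsq : ∑ i, (v (r i)) ^ 2 ≤ 2 * n / d := by
    have hv2 : ∑ j, (v j) ^ 2 = 1 := by
      have := EuclideanSpace.real_norm_sq_eq v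
      rw [hv] at this
      linarith
    rw [← Finset.sum_fiberwise Finset.univ r]
    calc _ ≤ ∑ j, (2 * n / d : ℝ) * (v j) ^ 2 := by
          apply Finset.sum_le_sum
          intro j _
          rw [Finset.sum_congr rfl (g := fun _ => (v j) ^ 2)
            (fun i hi => by rw [(Finset.mem_filter.1 hi).2]), Finset.sum_const, nsmul_eq_mul]
          apply mul_le_mul_of_nonneg_right _ (sq_nonneg _)
          refine le_trans ?_ hcount
          exact_mod_cast card_residue_le d n hd j
      _ = _ := by rw [← Finset.mul_sum, hv2, mul_one]
  have hpt : ∀ x : ℝ, |x| ^ p ≤ (2 / d : ℝ) ^ (p / 2) * (1 + p / 2 * (x ^ 2 / (2 / d) - 1)) := by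
    intro x
    have hM : (0 : ℝ) < 2 / d := by positivity
    have hnn : 0 ≤ x ^ 2 / (2 / d : ℝ) := by positivity
    have hb := rpow_one_add_le_one_add_mul_self (s := x ^ 2 / (2 / d : ℝ) - 1) (by linarith)
      (p := p / 2) (by linarith) (by linarith)
    have he : |x| ^ p = (2 / d : ℝ) ^ (p / 2) * (x ^ 2 / (2 / d : ℝ)) ^ (p / 2) := by
      rw [← Real.mul_rpow hM.le hnn, mul_div_cancel₀ _ hM.ne', ← sq_abs, ← Real.rpow_natCast,
        ← Real.rpow_mul (abs_nonneg x)]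
      congr 1
      push_cast
      ring
    rw [he]
    apply mul_le_mul_of_nonneg_left _ (by positivity)
    simpa using hb
  have hconst : (2 : ℝ) ^ (p / 2) * n * (d : ℝ) ^ (-(p / 2)) = (2 / d : ℝ) ^ (p / 2) * n := by
    rw [Real.div_rpow (by norm_num) hd0.le, Real.rpow_neg hd0.le]
    ring
  rw [hconst]
  refine (Finset.sum_le_sum fun i _ => hpt (v (r i))).trans ?_
  rw [← Finset.mul_sum]
  apply mul_le_mul_of_nonneg_left _ (by positivity)
  rw [Finset.sum_add_distrib, ← Finset.mul_sum, Finset.sum_sub_distrib, ← Finset.sum_div]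
  simp only [Finset.sum_const, Finset.card_univ, Fintype.card_fin, nsmul_eq_mul, mul_one]
  have : (∑ i, (v (r i)) ^ 2) / (2 / d : ℝ) ≤ n := by
    rw [div_le_iff₀ (by positivity)]
    refine hsq.trans (le_of_eq ?_)
    ring
  nlinarith
end

section
/- Let u_1, …, u_n be unit vectors in ℝ^d and let f(v) = Σ_{i=1}^n |⟨v, u_i⟩| for unit vectors v. If v ∈ S^{d-1} is a maximizer of f over S^{d-1}, then ⟨v, u_i⟩ ≠ 0 for every index i = 1, …, n. -/
open scoped RealInnerProductSpace

/-- Any admissible choice of signs gives `∑ s i • u i = f(v) • v` at a maximizer `v`. -/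
lemma signed_sum_eq (d n : ℕ)
    (u : Fin n → EuclideanSpace ℝ (Fin d))
    (v : EuclideanSpace ℝ (Fin d)) (hv : ‖v‖ = 1)
    (hmax : ∀ w : EuclideanSpace ℝ (Fin d), ‖w‖ = 1 →
      ∑ i, |⟪w, u i⟫| ≤ ∑ i, |⟪v, u i⟫|)
    (s : Fin n → ℝ) (hs : ∀ i, |s i| ≤ 1) (hsv : ∀ i, s i * ⟪v, u i⟫ = |⟪v, u i⟫|) :
    ∑ i, s i • u i = (∑ i, |⟪v, u i⟫|) • v := by
  set M := ∑ i, |⟪v, u i⟫| with hM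
  set S := ∑ i, s i • u i with hS
  have hM0 : 0 ≤ M := Finset.sum_nonneg fun i _ => abs_nonneg _
  have hin : ∀ w, ⟪w, S⟫ = ∑ i, s i * ⟪w, u i⟫ := by
    intro w
    rw [hS, inner_sum]
    exact Finset.sum_congr rfl fun i _ => by rw [real_inner_smul_right]
  have hvS : ⟪v, S⟫ = M := by
    rw [hin, hM]
    exact Finset.sum_congr rfl fun i _ => hsv i
  have hle : ‖S‖ ≤ M := by
    by_cases h0 : S = 0
    · rw [h0, norm_zero]; exact hM0
    have hp : 0 < ‖S‖ := norm_pos_iff.mpr h0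
    have hw : ‖(‖S‖⁻¹ • S)‖ = 1 := by
      rw [norm_smul, norm_inv, norm_norm, inv_mul_cancel₀ hp.ne']
    have h1 := hmax _ hw
    have h2 : ⟪‖S‖⁻¹ • S, S⟫ = ‖S‖ := by
      rw [real_inner_smul_left, real_inner_self_eq_norm_sq]
      field_simp
    rw [← h2, hin]
    refine le_trans (Finset.sum_le_sum fun i _ => ?_) h1
    refine (le_abs_self _).trans ?_
    rw [abs_mul]
    exact mul_le_of_le_one_left (abs_nonneg _) (hs i)
  have h3 : ‖S - M • v‖ ^ 2 ≤ 0 := by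
    rw [norm_sub_sq_real, real_inner_smul_right, real_inner_comm, hvS, norm_smul, hv,
      Real.norm_eq_abs, mul_one, sq_abs]
    nlinarith [norm_nonneg S]
  have h4 : ‖S - M • v‖ = 0 := by
    have := sq_nonneg ‖S - M • v‖
    exact pow_eq_zero_iff two_ne_zero |>.mp (le_antisymm h3 this)
  exact sub_eq_zero.mp (norm_eq_zero.mp h4)

/-- If `v` maximizes `f(w) = ∑ i, |⟨w, u i⟩|` over the unit sphere, then `⟨v, u i⟩ ≠ 0`
for every index `i`. -/
theorem maximizer_not_orthogonal (d n : ℕ)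
    (u : Fin n → EuclideanSpace ℝ (Fin d)) (hu : ∀ i, ‖u i‖ = 1)
    (v : EuclideanSpace ℝ (Fin d)) (hv : ‖v‖ = 1)
    (hmax : ∀ w : EuclideanSpace ℝ (Fin d), ‖w‖ = 1 →
      ∑ i, |⟪w, u i⟫| ≤ ∑ i, |⟪v, u i⟫|) :
    ∀ i, ⟪v, u i⟫ ≠ 0 := by
  intro k hk
  have hb : ∀ x : ℝ, |(SignType.sign x : ℝ)| ≤ 1 := by
    intro x
    rcases lt_trichotomy x 0 with h | h | h <;> simp [h]
  have h1 := signed_sum_eq d n u v hv hmax (fun i => (SignType.sign ⟪v, u i⟫ : ℝ))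
    (fun i => hb _) (fun i => sign_mul_self _)
  have h2 := signed_sum_eq d n u v hv hmax
    (fun i => (SignType.sign ⟪v, u i⟫ : ℝ) + if i = k then 1 else 0)
    (fun i => by
      by_cases h : i = k
      · subst h; simp [hk]
      · simpa [h] using hb _)
    (fun i => by
      by_cases h : i = k
      · subst h; simp [hk]
      · simp [h])
  simp only [add_smul, Finset.sum_add_distrib, h1, ite_smul, one_smul, zero_smul,
    Finset.sum_ite_eq', Finset.mem_univ, if_true] at h2
  have h3 : u k = 0 := by simpa using h2
  have := hu k
  simp [h3] at this
end

section
/- For all integers n ≥ d ≥ 1, the quantity min over sequences (u_1, …, u_n) of unit vectors in ℝ^d of max over sign sequences ε ∈ {−1, 1}^n of |Σ_{i=1}^n ε_i u_i| is at least n·μ_{d,1} and at most √2 · n · d^{−1/2}, where μ_{d,1} = Γ(d/2)/(√π · Γ((d+1)/2)); in particular it is of order Θ(n/√d). -/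
/-- `μ_{d,1} = Γ(d/2)·Γ(1)/(√π · Γ((d+1)/2))`. -/
noncomputable def polarizationMuOne (d : ℕ) : ℝ :=
  Real.Gamma (d / 2) * Real.Gamma 1 / (Real.sqrt Real.pi * Real.Gamma ((d + 1) / 2))

open MeasureTheory in
theorem aux_radial (d : ℕ) (hd : 1 ≤ d) :
    ∫ x : EuclideanSpace ℝ (Fin d), ‖x‖ * Real.exp (-‖x‖ ^ 2) =
      Real.sqrt Real.pi ^ d * Real.Gamma ((d + 1) / 2) / Real.Gamma (d / 2) := by
  have : Nonempty (Fin d) := ⟨⟨0, hd⟩⟩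
  have hdpos : (0 : ℝ) < d := by exact_mod_cast hd
  rw [integral_fun_norm_addHaar volume (fun r : ℝ => r * Real.exp (-r ^ 2))]
  have h1 : ∫ y in Set.Ioi (0 : ℝ), y ^ (Module.finrank ℝ (EuclideanSpace ℝ (Fin d)) - 1) •
      (y * Real.exp (-y ^ 2)) = 1 / 2 * Real.Gamma ((d + 1) / 2) := by
    rw [← integral_rpow_mul_exp_neg_rpow (p := 2) (q := d) (by norm_num) (by linarith)]
    apply setIntegral_congr_fun measurableSet_Ioi
    intro y _
    obtain ⟨m, rfl⟩ : ∃ m, d = m + 1 := ⟨d - 1, by omega⟩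
    simp only [finrank_euclideanSpace, Fintype.card_fin, Nat.add_sub_cancel, smul_eq_mul,
      Real.rpow_natCast, Real.rpow_two]
    ring
  rw [h1, measureReal_def, EuclideanSpace.volume_ball]
  have hG : 0 < Real.Gamma ((d : ℝ) / 2) := Real.Gamma_pos_of_pos (by positivity)
  have hG1 : Real.Gamma ((d : ℝ) / 2 + 1) = d / 2 * Real.Gamma ((d : ℝ) / 2) :=
    Real.Gamma_add_one (by positivity)
  have : 0 ≤ Real.sqrt Real.pi ^ d / (d / 2 * Real.Gamma ((d : ℝ) / 2)) := by positivity
  simp only [finrank_euclideanSpace, Fintype.card_fin, hG1, ENNReal.ofReal_one, one_pow, one_mul,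
    ENNReal.toReal_ofReal this, nsmul_eq_mul, smul_eq_mul]
  field_simp

open MeasureTheory in
theorem aux_abs_gauss : ∫ t : ℝ, |t| * Real.exp (-t ^ 2) = 1 := by
  have h := integral_comp_abs (f := fun t : ℝ => t * Real.exp (-t ^ 2))
  simp only [sq_abs] at h
  rw [h]
  have h1 : ∫ t in Set.Ioi (0 : ℝ), t * Real.exp (-t ^ 2) = 1 / 2 * Real.Gamma ((1 + 1) / 2) := by
    rw [← integral_rpow_mul_exp_neg_rpow (p := 2) (q := 1) (by norm_num) (by norm_num)]
    simp
  rw [h1]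
  norm_num

open MeasureTheory in
theorem aux_coord (d : ℕ) (i0 : Fin d) :
    ∫ x : EuclideanSpace ℝ (Fin d), |x i0| * Real.exp (-‖x‖ ^ 2) =
      Real.sqrt Real.pi ^ (d - 1) := by
  rw [← (PiLp.volume_preserving_toLp (Fin d)).integral_comp
    (MeasurableEquiv.toLp 2 _).measurableEmbedding]
  have h : ∀ y : Fin d → ℝ, |(WithLp.toLp 2 y : EuclideanSpace ℝ (Fin d)) i0| *
      Real.exp (-‖(WithLp.toLp 2 y : EuclideanSpace ℝ (Fin d))‖ ^ 2) =
      ∏ i, ((if i = i0 then |y i| else 1) * Real.exp (-(y i) ^ 2)) := by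
    intro y
    rw [Finset.prod_mul_distrib, ← Real.exp_sum, EuclideanSpace.real_norm_sq_eq]
    simp
  simp only [h]
  rw [integral_fintype_prod_volume_eq_prod
    (fun (i : Fin d) (t : ℝ) => (if i = i0 then |t| else 1) * Real.exp (-t ^ 2))]
  have h2 : ∀ i : Fin d, ∫ t : ℝ, (if i = i0 then |t| else 1) * Real.exp (-t ^ 2) =
      if i = i0 then 1 else Real.sqrt Real.pi := by
    intro i
    split_ifs
    · exact aux_abs_gauss
    · have := integral_gaussian 1
      simpa using this
  simp only [h2]
  rw [Finset.prod_ite]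
  simp [Finset.filter_ne']

open MeasureTheory in
theorem aux_inner (d : ℕ) (hd : 1 ≤ d) (u : EuclideanSpace ℝ (Fin d)) (hu : ‖u‖ = 1) :
    ∫ x : EuclideanSpace ℝ (Fin d), |inner ℝ u x| * Real.exp (-‖x‖ ^ 2) =
      Real.sqrt Real.pi ^ (d - 1) := by
  let i0 : Fin d := ⟨0, hd⟩
  obtain ⟨b, hb⟩ := Orthonormal.exists_orthonormalBasis_extension_of_card_eq (𝕜 := ℝ)
    (E := EuclideanSpace ℝ (Fin d)) (ι := Fin d) (by simp) (v := fun _ => u) (s := {i0})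
    (by
      rw [orthonormal_iff_ite]
      rintro ⟨i, hi⟩ ⟨j, hj⟩
      simp only [Set.mem_singleton_iff] at hi hj
      subst hi hj
      simp [Set.domRestrict, hu])
  have hb0 : b i0 = u := hb i0 rfl
  have h := b.measurePreserving_repr.integral_comp
    b.repr.toHomeomorph.measurableEmbedding
    (fun x : EuclideanSpace ℝ (Fin d) => |x i0| * Real.exp (-‖x‖ ^ 2))
  rw [← aux_coord d i0, ← h]
  simp [b.repr_apply_apply, hb0]

theorem aux_upper (d n : ℕ) (hd : 1 ≤ d) (hn : d ≤ n) :
    ∃ u : Fin n → EuclideanSpace ℝ (Fin d), (∀ i, ‖u i‖ = 1) ∧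
      ∀ ε : Fin n → ℝ, (∀ i, ε i = 1 ∨ ε i = -1) →
        ‖∑ i, ε i • u i‖ ≤ Real.sqrt 2 * n * (d : ℝ) ^ (-(1 / 2 : ℝ)) := by
  classical
  have hdpos : (0 : ℝ) < d := by exact_mod_cast hd
  let r : Fin n → Fin d := fun i => ⟨i % d, Nat.mod_lt _ hd⟩
  refine ⟨fun i => EuclideanSpace.single (r i) 1, fun i => by simp, fun ε hε => ?_⟩
  let S : Fin d → Finset (Fin n) := fun j => Finset.univ.filter (fun i => r i = j)
  have hcard : ∀ j, (S j).card ≤ n / d + 1 := by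
    intro j
    rw [← Finset.card_range (n / d + 1)]
    apply Finset.card_le_card_of_injOn (fun i : Fin n => (i : ℕ) / d)
    · intro i _
      simp only [Finset.coe_range, Set.mem_Iio]
      exact Nat.lt_succ_of_le (Nat.div_le_div_right i.2.le)
    · intro i hi k hk hik
      simp only [S, Finset.coe_filter, Set.mem_setOf_eq, Finset.mem_univ, true_and] at hi hk
      have h1 : (i : ℕ) % d = (k : ℕ) % d := by
        have := hi.trans hk.symm
        simpa [r] using this
      apply Fin.ext
      simp only at hik
      rw [← Nat.div_add_mod (i : ℕ) d, ← Nat.div_add_mod (k : ℕ) d, h1, hik]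
  have hsum : ∑ j, (S j).card = n := by
    have := Finset.card_eq_sum_card_fiberwise (f := r) (s := Finset.univ) (t := Finset.univ)
      (by intro x _; simp)
    simpa [S] using this.symm
  have hcoord : ∀ j, (∑ i, ε i • (EuclideanSpace.single (r i) (1 : ℝ))) j = ∑ i ∈ S j, ε i := by
    intro j
    simp [S, Finset.sum_filter, Pi.single_apply, eq_comm]
  have habs : ∀ j, |∑ i ∈ S j, ε i| ≤ (S j).card := by
    intro j
    refine (Finset.abs_sum_le_sum_abs _ _).trans ?_
    have : ∀ i ∈ S j, |ε i| ≤ 1 := by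
      intro i _
      rcases hε i with h | h <;> simp [h]
    simpa using Finset.sum_le_sum this
  have hsq : ‖∑ i, ε i • (EuclideanSpace.single (r i) (1 : ℝ))‖ ^ 2 ≤ 2 * (n : ℝ) ^ 2 / d := by
    rw [EuclideanSpace.real_norm_sq_eq]
    have hk : ((n / d : ℕ) : ℝ) * d ≤ n := by exact_mod_cast Nat.div_mul_le_self n d
    have hn' : (d : ℝ) ≤ n := by exact_mod_cast hn
    calc ∑ j, ((∑ i, ε i • (EuclideanSpace.single (r i) (1 : ℝ))) j) ^ 2
        ≤ ∑ j, (((n / d : ℕ) : ℝ) + 1) * (S j).card := by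
          apply Finset.sum_le_sum
          intro j _
          rw [hcoord, ← sq_abs]
          have h1 : ((S j).card : ℝ) ≤ ((n / d : ℕ) : ℝ) + 1 := by exact_mod_cast hcard j
          have h2 := habs j
          nlinarith [abs_nonneg (∑ i ∈ S j, ε i)]
      _ = (((n / d : ℕ) : ℝ) + 1) * n := by
          rw [← Finset.mul_sum]
          congr 1
          exact_mod_cast hsum
      _ ≤ 2 * (n : ℝ) ^ 2 / d := by
          rw [le_div_iff₀ hdpos]
          nlinarith
  have hrpow : (d : ℝ) ^ (-(1 / 2 : ℝ)) = (Real.sqrt d)⁻¹ := by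
    rw [Real.rpow_neg hdpos.le, Real.sqrt_eq_rpow]
  rw [hrpow]
  refine (sq_le_sq₀ (norm_nonneg _) (by positivity)).1 ?_
  refine hsq.trans (le_of_eq ?_)
  rw [mul_pow, mul_pow, inv_pow, Real.sq_sqrt (by norm_num), Real.sq_sqrt hdpos.le]
  ring

open MeasureTheory in
theorem aux_lower (d n : ℕ) (hd : 1 ≤ d)
    (u : Fin n → EuclideanSpace ℝ (Fin d)) (hu : ∀ i, ‖u i‖ = 1) :
      ∃ ε : Fin n → ℝ, (∀ i, ε i = 1 ∨ ε i = -1) ∧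
        (n : ℝ) * polarizationMuOne d ≤ ‖∑ i, ε i • u i‖ := by
  let sg : Bool → ℝ := fun b => if b then 1 else -1
  obtain ⟨s, hs⟩ := Finite.exists_max (fun s : Fin n → Bool => ‖∑ i, sg (s i) • u i‖)
  refine ⟨fun i => sg (s i), fun i => by cases h : s i <;> simp [sg, h], ?_⟩
  set M := ‖∑ i, sg (s i) • u i‖ with hM
  have hdpos : (0 : ℝ) < d := by exact_mod_cast hd
  have hpt : ∀ x : EuclideanSpace ℝ (Fin d), ∑ i, |inner ℝ (u i) x| ≤ M * ‖x‖ := by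
    intro x
    let t : Fin n → Bool := fun i => decide (0 ≤ inner ℝ (u i) x)
    have h1 : ∑ i, |inner ℝ (u i) x| = inner ℝ (∑ i, sg (t i) • u i) x := by
      rw [sum_inner]
      apply Finset.sum_congr rfl
      intro i _
      rw [real_inner_smul_left]
      by_cases h : 0 ≤ inner ℝ (u i) x
      · simp [sg, t, h, abs_of_nonneg h]
      · have h' := lt_of_not_ge h
        simp [sg, t, h, abs_of_neg h']
    rw [h1]
    exact (real_inner_le_norm _ _).trans (mul_le_mul_of_nonneg_right (hs t) (norm_nonneg _))
  have hpi : 0 < Real.sqrt Real.pi := Real.sqrt_pos.2 Real.pi_pos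
  have hG : 0 < Real.Gamma ((d : ℝ) / 2) := Real.Gamma_pos_of_pos (by positivity)
  have hG' : 0 < Real.Gamma (((d : ℝ) + 1) / 2) := Real.Gamma_pos_of_pos (by positivity)
  have hI1 := aux_radial d hd
  have hint1 : Integrable (fun x : EuclideanSpace ℝ (Fin d) => ‖x‖ * Real.exp (-‖x‖ ^ 2)) :=
    Integrable.of_integral_ne_zero (by rw [hI1]; positivity)
  have hint2 : ∀ i, Integrable (fun x : EuclideanSpace ℝ (Fin d) =>
      |inner ℝ (u i) x| * Real.exp (-‖x‖ ^ 2)) := fun i =>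
    Integrable.of_integral_ne_zero (by rw [aux_inner d hd (u i) (hu i)]; positivity)
  have hmono : ∫ x : EuclideanSpace ℝ (Fin d), ∑ i, |inner ℝ (u i) x| * Real.exp (-‖x‖ ^ 2) ≤
      ∫ x : EuclideanSpace ℝ (Fin d), M * (‖x‖ * Real.exp (-‖x‖ ^ 2)) := by
    apply integral_mono (integrable_finsetSum _ fun i _ => hint2 i) (hint1.const_mul M)
    intro x
    simp only
    rw [← Finset.sum_mul, ← mul_assoc]
    exact mul_le_mul_of_nonneg_right (hpt x) (Real.exp_pos _).le
  rw [integral_finsetSum _ fun i _ => hint2 i, integral_const_mul, hI1] at hmono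
  simp only [aux_inner d hd _ (hu _), Finset.sum_const, Finset.card_univ, Fintype.card_fin,
    nsmul_eq_mul] at hmono
  obtain ⟨m, rfl⟩ : ∃ m, d = m + 1 := ⟨d - 1, by omega⟩
  rw [Nat.add_sub_cancel] at hmono
  unfold polarizationMuOne
  rw [Real.Gamma_one, mul_one, ← mul_div_assoc, div_le_iff₀ (by positivity)]
  rw [← mul_div_assoc, le_div_iff₀ hG] at hmono
  have hp : 0 < Real.sqrt Real.pi ^ m := by positivity
  refine le_of_mul_le_mul_left ?_ hp
  calc _ = _ := by ring
    _ ≤ _ := hmono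
    _ = _ := by ring

/-- For `n ≥ d ≥ 1`, the min-max of `‖∑ ε_i u_i‖` over unit-vector configurations and sign
sequences is at least `n·μ_{d,1}` and at most `√2·n/√d` (hence of order `Θ(n/√d)`). -/
theorem minmax_signed_sum_bounds (d n : ℕ) (hd : 1 ≤ d) (hn : d ≤ n) :
    (∀ u : Fin n → EuclideanSpace ℝ (Fin d), (∀ i, ‖u i‖ = 1) →
      ∃ ε : Fin n → ℝ, (∀ i, ε i = 1 ∨ ε i = -1) ∧
        (n : ℝ) * polarizationMuOne d ≤ ‖∑ i, ε i • u i‖) ∧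
    (∃ u : Fin n → EuclideanSpace ℝ (Fin d), (∀ i, ‖u i‖ = 1) ∧
      ∀ ε : Fin n → ℝ, (∀ i, ε i = 1 ∨ ε i = -1) →
        ‖∑ i, ε i • u i‖ ≤ Real.sqrt 2 * n * (d : ℝ) ^ (-(1 / 2 : ℝ))) := by
  exact ⟨fun u hu => aux_lower d n hd u hu, aux_upper d n hd hn⟩
end

section
/- Let 0 < p ≤ 1 and n ≥ 2. Then the minimum over all sequences u_1, …, u_n of unit vectors in ℝ^2 of the maximum over unit vectors v ∈ S^1 of Σ_{i=1}^n |⟨v, u_i⟩|^p equals Σ_{k=1}^n |cos(kπ/n − π/(2n))|^p when n is even, and equals Σ_{k=1}^n |cos(kπ/n)|^p when n is odd; moreover, the minimum is attained by configurations equally distributed on the half-circle, i.e., u_k = (cos(kπ/n), sin(kπ/n)) for k = 1, …, n. -/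
open scoped RealInnerProductSpace
open Real

/-- The optimal polarization value on the circle for `0 < p ≤ 1`:
`∑_{k=1}^n |cos(kπ/n − π/(2n))|^p` for even `n` and `∑_{k=1}^n |cos(kπ/n)|^p` for odd `n`. -/
noncomputable def planarPolarizationValue (n : ℕ) (p : ℝ) : ℝ :=
  if Even n then ∑ k ∈ Finset.Icc 1 n, |Real.cos ((k : ℝ) * π / n - π / (2 * n))| ^ p
  else ∑ k ∈ Finset.Icc 1 n, |Real.cos ((k : ℝ) * π / n)| ^ p

/-- The configuration `u_k = (cos(kπ/n), sin(kπ/n))`, `k = 1, …, n`, equally distributed on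
the half-circle. -/
noncomputable def halfCircleConfig (n : ℕ) (k : Fin n) : EuclideanSpace ℝ (Fin 2) :=
  (WithLp.equiv 2 (Fin 2 → ℝ)).symm
    ![Real.cos (((k : ℕ) + 1 : ℝ) * π / n), Real.sin (((k : ℕ) + 1 : ℝ) * π / n)]

namespace PlanarPol

/-- The kernel `|sin t|^p`. -/
noncomputable def g (p t : ℝ) : ℝ := |Real.sin t| ^ p

lemma g_pi (p t : ℝ) : g p (t + π) = g p t := by
  simp [g, Real.sin_add_pi]

lemma g_reflect (p t : ℝ) : g p (π - t) = g p t := by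
  simp [g, Real.sin_pi_sub]

lemma g_concave (p : ℝ) (hp0 : 0 < p) (hp1 : p ≤ 1) : ConcaveOn ℝ (Set.Icc 0 π) (g p) := by
  refine ⟨convex_Icc _ _, ?_⟩
  intro x hx y hy a b ha hb hab
  have h1 := strictConcaveOn_sin_Icc.concaveOn.2 hx hy ha hb hab
  have hz := (convex_Icc (0:ℝ) π) hx hy ha hb hab
  have sx := Real.sin_nonneg_of_mem_Icc hx
  have sy := Real.sin_nonneg_of_mem_Icc hy
  have sz := Real.sin_nonneg_of_mem_Icc hz
  have h2 := (Real.concaveOn_rpow hp0.le hp1).2 (x := Real.sin x) sx (y := Real.sin y) sy ha hb hab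
  simp only [g, smul_eq_mul] at *
  rw [abs_of_nonneg sx, abs_of_nonneg sy, abs_of_nonneg sz]
  exact h2.trans (Real.rpow_le_rpow (by positivity) h1 hp0.le)

lemma g_diff (p : ℝ) (t : ℝ) (ht : t ∈ Set.Ioo 0 π) : DifferentiableAt ℝ (g p) t := by
  have hs := Real.sin_pos_of_mem_Ioo ht
  have : DifferentiableAt ℝ (fun t => |Real.sin t|) t :=
    (differentiableAt_abs hs.ne').comp t Real.differentiableAt_sin
  exact this.rpow_const (Or.inl (abs_pos.2 hs.ne').ne')

lemma g_tangent (p : ℝ) (hp0 : 0 < p) (hp1 : p ≤ 1) {y z : ℝ} (hy : y ∈ Set.Ioo 0 π)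
    (hz : z ∈ Set.Ioo 0 π) : g p z ≤ g p y + deriv (g p) y * (z - y) := by
  have hc := (g_concave p hp0 hp1).subset Set.Ioo_subset_Icc_self (convex_Ioo _ _)
  have hd := g_diff p y hy
  rcases lt_trichotomy y z with h | h | h
  · have := hc.slope_le_deriv hy hz h hd
    rw [slope_def_field, div_le_iff₀ (by linarith)] at this
    linarith
  · subst h; simp
  · have := hc.deriv_le_slope hz hy h hd
    rw [slope_def_field, le_div_iff₀ (by linarith)] at this
    linarith

lemma abel_sum_le (n : ℕ) (s d : ℕ → ℝ)
    (hs : ∀ i, i + 1 < n → s (i + 1) ≤ s i)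
    (hd : ∀ k, k ≤ n → ∑ i ∈ Finset.range k, d i ≤ 0) :
    ∀ m, m + 1 ≤ n → ∑ i ∈ Finset.range (m + 1), s i * d i
      ≤ s m * ∑ i ∈ Finset.range (m + 1), d i := by
  intro m
  induction m with
  | zero => intro _; simp
  | succ m ih =>
    intro h
    rw [Finset.sum_range_succ, Finset.sum_range_succ d]
    have h1 := ih (by omega)
    have h2 := hd (m + 1) (by omega)
    have h3 := hs m (by omega)
    nlinarith

lemma karamata (p : ℝ) (hp0 : 0 < p) (hp1 : p ≤ 1) (n : ℕ) (hn : 0 < n) (y z : ℕ → ℝ)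
    (hy : ∀ i < n, y i ∈ Set.Ioo 0 π) (hz : ∀ i < n, z i ∈ Set.Ioo 0 π)
    (hm : Monotone y)
    (hd : ∀ k, k ≤ n → ∑ i ∈ Finset.range k, (z i - y i) ≤ 0)
    (hd0 : ∑ i ∈ Finset.range n, (z i - y i) = 0) :
    ∑ i ∈ Finset.range n, g p (z i) ≤ ∑ i ∈ Finset.range n, g p (y i) := by
  have hc := (g_concave p hp0 hp1).subset Set.Ioo_subset_Icc_self (convex_Ioo _ _)
  have ha := hc.antitoneOn_deriv (g_diff p)
  have h1 := abel_sum_le n (fun i => deriv (g p) (y i)) (fun i => z i - y i)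
    (fun i hi => ha (hy i (by omega)) (hy (i + 1) hi) (hm (Nat.le_succ i))) hd (n - 1) (by omega)
  rw [Nat.sub_add_cancel hn, hd0, mul_zero] at h1
  have h2 : ∑ i ∈ Finset.range n, g p (z i) ≤
      ∑ i ∈ Finset.range n, (g p (y i) + deriv (g p) (y i) * (z i - y i)) :=
    Finset.sum_le_sum fun i hi =>
      g_tangent p hp0 hp1 (hy i (Finset.mem_range.1 hi)) (hz i (Finset.mem_range.1 hi))
  rw [Finset.sum_add_distrib] at h2
  linarith

lemma sum_shift (n : ℕ) (f : ℕ → ℝ) (hf : ∀ i, f (i + n) = f i) (j : ℕ) :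
    ∑ i ∈ Finset.range n, f (j + i) = ∑ i ∈ Finset.range n, f i := by
  induction j with
  | zero => simp
  | succ j ih =>
    rw [← ih]
    have h1 := Finset.sum_range_succ (fun i => f (j + i)) n
    have h2 := Finset.sum_range_succ' (fun i => f (j + i)) n
    have h3 : ∀ i, f (j + 1 + i) = f (j + (i + 1)) := fun i => by congr 1; omega
    simp only [h3]
    simp only [hf, add_zero] at h1 h2
    linarith

/-- Value: the potential of equally spaced points. -/
noncomputable def H (p : ℝ) (n : ℕ) (x : ℝ) : ℝ :=
  ∑ i ∈ Finset.range n, g p ((i : ℝ) * π / n + x)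

lemma H_periodic (p : ℝ) (n : ℕ) (hn : 0 < n) : Function.Periodic (H p n) (π / n) := by
  intro x
  have hn' : (n : ℝ) ≠ 0 := by positivity
  have h1 := Finset.sum_range_succ (fun i : ℕ => g p ((i : ℝ) * π / n + x)) n
  have h2 := Finset.sum_range_succ' (fun i : ℕ => g p ((i : ℝ) * π / n + x)) n
  have h3 : g p ((n : ℝ) * π / n + x) = g p (((0:ℕ) : ℝ) * π / n + x) := by
    rw [mul_div_cancel_left₀ _ hn', add_comm, g_pi]; simp
  have h4 : ∀ i : ℕ, g p ((i : ℝ) * π / n + (x + π / n)) = g p (((i + 1 : ℕ) : ℝ) * π / n + x) := by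
    intro i; congr 1; push_cast; ring
  simp only [H, h4]
  rw [h3] at h1
  linarith

lemma H_reflect (p : ℝ) (n : ℕ) (hn : 0 < n) (x : ℝ) : H p n (π / n - x) = H p n x := by
  have hn' : (n : ℝ) ≠ 0 := by positivity
  simp only [H]
  rw [← Finset.sum_range_reflect]
  refine Finset.sum_congr rfl fun i hi => ?_
  have hi := Finset.mem_range.1 hi
  rw [← g_reflect]
  congr 1
  rw [Nat.sub_sub, Nat.cast_sub (by omega)]
  push_cast
  field_simp
  ring

lemma H_le (p : ℝ) (hp0 : 0 < p) (hp1 : p ≤ 1) (n : ℕ) (hn : 0 < n) (x : ℝ) :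
    H p n x ≤ H p n (π / (2 * n)) := by
  have hn' : (0 : ℝ) < n := by positivity
  obtain ⟨y, hy, hxy⟩ := (H_periodic p n hn).exists_mem_Ico₀ (by positivity) x
  rw [hxy]
  have h1 := H_reflect p n hn y
  suffices h : (H p n y + H p n (π / n - y)) / 2 ≤ H p n (π / (2 * n)) by linarith
  simp only [H]
  rw [← Finset.sum_add_distrib, Finset.sum_div]
  refine Finset.sum_le_sum fun i hi => ?_
  have hi := Finset.mem_range.1 hi
  have hi' : (i : ℝ) + 1 ≤ n := by exact_mod_cast hi
  have hb : (i : ℝ) * π / n + π / n ≤ π := by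
    rw [← add_div, div_le_iff₀ hn']; nlinarith [Real.pi_pos]
  have h0 : 0 ≤ (i : ℝ) * π / n := by positivity
  have hc := (g_concave p hp0 hp1).2 (show (i : ℝ) * π / n + y ∈ Set.Icc 0 π from ⟨by linarith [hy.1], by linarith [hy.2]⟩)
    (show (i : ℝ) * π / n + (π / n - y) ∈ Set.Icc 0 π from ⟨by linarith [hy.2], by linarith [hy.1]⟩)
    (show (0 : ℝ) ≤ 1 / 2 by norm_num) (show (0 : ℝ) ≤ 1 / 2 by norm_num) (by norm_num)
  simp only [smul_eq_mul] at hc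
  have he : 1 / 2 * ((i : ℝ) * π / n + y) + 1 / 2 * ((i : ℝ) * π / n + (π / n - y))
    = (i : ℝ) * π / n + π / (2 * n) := by field_simp; ring
  rw [he] at hc
  linarith

lemma cos_g (p t : ℝ) : |Real.cos t| ^ p = g p (t + π / 2) := by
  simp [g, Real.sin_add_pi_div_two]

lemma H_shift (p : ℝ) (n : ℕ) (hn : 0 < n) (x : ℝ) (m : ℕ) :
    H p n (x + m * (π / n)) = H p n x := (H_periodic p n hn).nat_mul m x

lemma value_eq (p : ℝ) (n : ℕ) (hn : 0 < n) :
    planarPolarizationValue n p = H p n (π / (2 * n)) := by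
  have hn' : (n : ℝ) ≠ 0 := by positivity
  unfold planarPolarizationValue
  have hI : ∀ f : ℕ → ℝ, ∑ k ∈ Finset.Icc 1 n, f k = ∑ i ∈ Finset.range n, f (i + 1) := by
    intro f
    rw [← Finset.sum_image (s := Finset.range n) (g := fun i => i + 1) (by intro a _ b _ h; simpa using h)]
    congr 1
    ext k
    simp only [Finset.mem_Icc, Finset.mem_image, Finset.mem_range]
    exact ⟨fun h => ⟨k - 1, by omega, by omega⟩, fun ⟨a, h1, h2⟩ => by omega⟩
  simp only [hI, cos_g]
  split_ifs with h
  · obtain ⟨m, hm⟩ := h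
    have hm' : (n : ℝ) = m + m := by exact_mod_cast hm
    rw [← H_shift p n hn _ m]
    refine Finset.sum_congr rfl fun i _ => ?_
    congr 1
    push_cast
    field_simp
    rw [hm']; ring
  · obtain ⟨m, hm⟩ := Nat.not_even_iff_odd.1 h
    have hm' : (n : ℝ) = 2 * m + 1 := by exact_mod_cast hm
    rw [← H_shift p n hn _ (m + 1)]
    refine Finset.sum_congr rfl fun i _ => ?_
    congr 1
    push_cast
    field_simp
    rw [hm']; ring

lemma rotation (n : ℕ) (hn : 0 < n) (T : ℕ → ℝ) (hT : Monotone T) (hper : ∀ i, T (i + n) = T i + π)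
    (p : ℝ) (hp0 : 0 < p) (hp1 : p ≤ 1) :
    ∃ x, H p n (π / (2 * n)) ≤ ∑ i ∈ Finset.range n, g p (T i - x) := by
  have hn' : (0 : ℝ) < n := by positivity
  set c : ℝ := (∑ i ∈ Finset.range n, (T i - i * π / n)) / n with hc
  set b : ℕ → ℝ := fun i => T i - i * π / n - c with hb
  set B : ℕ → ℝ := fun m => ∑ i ∈ Finset.range m, b i with hB
  have hbper : ∀ i, b (i + n) = b i := by
    intro i
    simp only [hb, hper]; push_cast; field_simp; ring
  have hBn : B n = 0 := by
    simp only [hB, hb]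
    rw [Finset.sum_sub_distrib, Finset.sum_const, Finset.card_range, nsmul_eq_mul, hc,
      mul_div_cancel₀ _ hn'.ne', sub_self]
  have hBper : ∀ m, B (n + m) = B m := by
    intro m
    have : B (n + m) = B n + ∑ i ∈ Finset.range m, b (n + i) := Finset.sum_range_add _ _ _
    rw [this, hBn, zero_add]
    exact Finset.sum_congr rfl fun i _ => by rw [add_comm, hbper]
  obtain ⟨j, hj, hmin⟩ := Finset.exists_min_image (Finset.range n) B ⟨0, Finset.mem_range.2 hn⟩
  have hj := Finset.mem_range.1 hj
  have hS : ∀ k, ∑ i ∈ Finset.range k, b (j + i) = B (j + k) - B j := by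
    intro k
    have : B (j + k) = B j + ∑ i ∈ Finset.range k, b (j + i) := Finset.sum_range_add _ _ _
    linarith
  have hS0 : ∀ k ≤ n, 0 ≤ ∑ i ∈ Finset.range k, b (j + i) := by
    intro k hk
    rw [hS]
    by_cases h : j + k < n
    · linarith [hmin (j + k) (Finset.mem_range.2 h)]
    · have h2 := hBper (j + k - n)
      rw [show n + (j + k - n) = j + k by omega] at h2
      by_cases h3 : j + k - n < n
      · linarith [hmin (j + k - n) (Finset.mem_range.2 h3)]
      · omega
  have hSn : ∑ i ∈ Finset.range n, b (j + i) = 0 := by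
    rw [hS, add_comm j n, hBper]; ring
  set x : ℝ := c + j * π / n - π / (2 * n) with hx
  set y : ℕ → ℝ := fun i => T (j + i) - x with hy
  set z : ℕ → ℝ := fun i => (i : ℝ) * π / n + π / (2 * n) with hz
  have hyz : ∀ i, z i - y i = - b (j + i) := by
    intro i; simp only [hz, hy, hx, hb]; push_cast; field_simp; ring
  have hmy : Monotone y := fun a b hab => by
    have := hT (Nat.add_le_add_left hab j)
    simp only [hy]; linarith
  have hz0 : ∀ i < n, z i ∈ Set.Ioo 0 π := by
    intro i hi
    have hi' : (i : ℝ) + 1 ≤ n := by exact_mod_cast hi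
    refine ⟨by simp only [hz]; positivity, ?_⟩
    have : z i = ((i : ℝ) + 1 / 2) * π / n := by simp only [hz]; field_simp
    rw [this, div_lt_iff₀ hn']; nlinarith [Real.pi_pos]
  have hyfirst : z 0 ≤ y 0 := by
    have := hS0 1 hn
    simp only [Finset.sum_range_one] at this
    linarith [hyz 0]
  have hylast : y (n - 1) ≤ z (n - 1) := by
    have h1 := Finset.sum_range_succ (fun i => b (j + i)) (n - 1)
    rw [Nat.sub_add_cancel hn, hSn] at h1
    linarith [hS0 (n - 1) (by omega), hyz (n - 1)]
  have hy0 : ∀ i < n, y i ∈ Set.Ioo 0 π := fun i hi =>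
    ⟨by linarith [(hz0 0 hn).1, hmy (Nat.zero_le i)],
      by linarith [(hz0 (n - 1) (by omega)).2, hmy (show i ≤ n - 1 by omega)]⟩
  refine ⟨x, ?_⟩
  have hk := karamata p hp0 hp1 n hn y z hy0 hz0 hmy
    (fun k hk => by simp only [hyz, Finset.sum_neg_distrib]; linarith [hS0 k hk])
    (by simp only [hyz, Finset.sum_neg_distrib]; linarith [hSn])
  have hsh := sum_shift n (fun i => g p (T i - x))
    (fun i => by rw [hper, show T i + π - x = (T i - x) + π by ring, g_pi]) j
  rw [← hsh]
  exact hk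

lemma exists_rotation_config (n : ℕ) (hn : 0 < n) (t : Fin n → ℝ) (p : ℝ) (hp0 : 0 < p) (hp1 : p ≤ 1) :
    ∃ x, H p n (π / (2 * n)) ≤ ∑ i, g p (t i - x) := by
  have hgp : ∀ x, Function.Periodic (fun s => g p (s - x)) π := fun x s => by
    show g p (s + π - x) = g p (s - x)
    rw [show s + π - x = (s - x) + π by ring, g_pi]
  set r : Fin n → ℝ := fun i => toIcoMod Real.pi_pos 0 (t i) with hr
  have hr0 : ∀ i, r i ∈ Set.Ico 0 π := fun i => by
    simpa using toIcoMod_mem_Ico Real.pi_pos 0 (t i)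
  have hrt : ∀ x i, g p (r i - x) = g p (t i - x) := fun x i => by
    have h := (hgp x).int_mul (toIcoDiv Real.pi_pos 0 (t i)) (r i)
    simp only [hr, toIcoMod_add_toIcoDiv_mul] at h
    exact h.symm
  set σ := Tuple.sort r
  have hmono : Monotone (r ∘ σ) := Tuple.monotone_sort r
  set T : ℕ → ℝ := fun i => r (σ ⟨i % n, Nat.mod_lt _ hn⟩) + ((i / n : ℕ) : ℝ) * π with hTdef
  have hT : Monotone T := by
    intro a b hab
    simp only [hTdef]
    rcases (Nat.div_le_div_right (c := n) hab).eq_or_lt with h | h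
    · rw [h]
      have : a % n ≤ b % n := by
        have h1 := Nat.div_add_mod a n
        have h2 := Nat.div_add_mod b n
        rw [h] at h1
        omega
      have := hmono (show (⟨a % n, Nat.mod_lt _ hn⟩ : Fin n) ≤ ⟨b % n, Nat.mod_lt _ hn⟩ from this)
      simp only [Function.comp] at this
      linarith
    · have h1 := (hr0 (σ ⟨a % n, Nat.mod_lt _ hn⟩)).2
      have h2 := (hr0 (σ ⟨b % n, Nat.mod_lt _ hn⟩)).1
      have h3 : ((a / n : ℕ) : ℝ) + 1 ≤ ((b / n : ℕ) : ℝ) := by exact_mod_cast h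
      nlinarith [Real.pi_pos]
  have hper : ∀ i, T (i + n) = T i + π := by
    intro i
    simp only [hTdef, Nat.add_mod_right, Nat.add_div_right _ hn]
    push_cast; ring
  obtain ⟨x, hx⟩ := rotation n hn T hT hper p hp0 hp1
  refine ⟨x, hx.trans_eq ?_⟩
  rw [Finset.sum_range]
  have : ∀ i : Fin n, g p (T i - x) = g p (t (σ i) - x) := by
    intro i
    rw [← hrt]
    simp [hTdef, Nat.mod_eq_of_lt i.2, Nat.div_eq_of_lt i.2]
  simp only [this]
  exact Equiv.sum_comp σ (fun i => g p (t i - x))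

lemma exists_angle (v : EuclideanSpace ℝ (Fin 2)) (hv : ‖v‖ = 1) :
    ∃ a, v 0 = Real.cos a ∧ v 1 = Real.sin a := by
  have h : v 0 ^ 2 + v 1 ^ 2 = 1 := by
    have := EuclideanSpace.real_norm_sq_eq v
    rw [hv, Fin.sum_univ_two] at this
    linarith
  have hz : ‖(⟨v 0, v 1⟩ : ℂ)‖ = 1 := by
    rw [Complex.norm_def, Complex.normSq_mk, ← sq, ← sq, h, Real.sqrt_one]
  refine ⟨Complex.arg ⟨v 0, v 1⟩, ?_, ?_⟩
  · have := Complex.norm_mul_cos_arg ⟨v 0, v 1⟩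
    rw [hz, one_mul] at this; exact this.symm
  · have := Complex.norm_mul_sin_arg ⟨v 0, v 1⟩
    rw [hz, one_mul] at this; exact this.symm

lemma inner_angle (v u : EuclideanSpace ℝ (Fin 2)) (a b : ℝ) (hv0 : v 0 = Real.cos a)
    (hv1 : v 1 = Real.sin a) (hu0 : u 0 = Real.cos b) (hu1 : u 1 = Real.sin b) :
    ⟪v, u⟫ = Real.cos (b - a) := by
  rw [PiLp.inner_apply, Fin.sum_univ_two, hv0, hv1, hu0, hu1, Real.cos_sub]
  simp

end PlanarPol

/-- For `0 < p ≤ 1` and `n ≥ 2`, the `n`-th `ℓ_p`-polarization constant of `S¹` equals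
`∑_{k=1}^n |cos(kπ/n − π/(2n))|^p` for even `n` and `∑_{k=1}^n |cos(kπ/n)|^p` for odd `n`;
moreover, it is attained by the configuration equally spaced on the half-circle. -/
theorem planar_polarization_constant (n : ℕ) (hn : 2 ≤ n) (p : ℝ) (hp0 : 0 < p)
    (hp1 : p ≤ 1) :
    (∀ u : Fin n → EuclideanSpace ℝ (Fin 2), (∀ i, ‖u i‖ = 1) →
      ∃ v : EuclideanSpace ℝ (Fin 2), ‖v‖ = 1 ∧
        planarPolarizationValue n p ≤ ∑ i, |⟪v, u i⟫| ^ p) ∧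
    (∀ v : EuclideanSpace ℝ (Fin 2), ‖v‖ = 1 →
      ∑ k, |⟪v, halfCircleConfig n k⟫| ^ p ≤ planarPolarizationValue n p) := by
  have hn0 : 0 < n := by omega
  rw [PlanarPol.value_eq p n hn0]
  constructor
  · intro u hu
    choose t ht0 ht1 using fun i => PlanarPol.exists_angle (u i) (hu i)
    obtain ⟨x, hx⟩ := PlanarPol.exists_rotation_config n hn0 t p hp0 hp1
    refine ⟨!₂[Real.cos (x + π / 2), Real.sin (x + π / 2)], ?_, hx.trans_eq ?_⟩
    · rw [EuclideanSpace.norm_eq, Fin.sum_univ_two]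
      simp
    · refine Finset.sum_congr rfl fun i _ => ?_
      rw [PlanarPol.inner_angle _ (u i) (x + π / 2) (t i) (by simp) (by simp) (ht0 i) (ht1 i),
        PlanarPol.cos_g]
      congr 1; ring
  · intro v hv
    obtain ⟨a, h0, h1⟩ := PlanarPol.exists_angle v hv
    refine le_trans (le_of_eq ?_) (PlanarPol.H_le p hp0 hp1 n hn0 (π / n - a + π / 2))
    simp only [PlanarPol.H]
    rw [Finset.sum_range]
    refine Finset.sum_congr rfl fun i _ => ?_
    rw [PlanarPol.inner_angle v _ a (((i : ℕ) + 1 : ℝ) * π / n) h0 h1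
      (by simp [halfCircleConfig]) (by simp [halfCircleConfig]), PlanarPol.cos_g]
    congr 1; ring
end
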